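/- Let K be a field of characteristic zero and let G be a Noetherian Lie algebra over K which is just-infinite (G is infinite-dimensional over K and every nonzero Lie ideal of G has finite codimension in G). Then every nonzero Lie ideal a of G, regarded as a Lie algebra, is itself just-infinite: a is infinite-dimensional and every nonzero Lie ideal of a has finite codimension in a. -/

import Mathlib

/-- A Lie algebra is weakly Noetherian if `m/[m,m]` is finite dimensional over `K` for every
Lie subalgebra `m`. -/
def WeaklyNoetherian (K G : Type*) [Field K] [LieRing G] [LieAlgebra K G] : Prop :=
  ∀ m : LieSubalgebra K G,
    FiniteDimensional K (↥m ⧸ LieAlgebra.derivedSeries K ↥m 1)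

/-- An ideal is characteristic if it is preserved by every derivation. -/
def IsCharacteristicIdeal (K G : Type*) [Field K] [LieRing G] [LieAlgebra K G]
    (m : LieIdeal K G) : Prop :=
  ∀ D : LieDerivation K G G, ∀ x ∈ m, D x ∈ m

/-- A Lie algebra is Noetherian if it is weakly Noetherian and every ascending chain of
characteristic ideals stabilizes. -/
def LieNoetherian (K G : Type*) [Field K] [LieRing G] [LieAlgebra K G] : Prop :=
  WeaklyNoetherian K G ∧
    ∀ c : ℕ → LieIdeal K G, Monotone c → (∀ k, IsCharacteristicIdeal K G (c k)) →
      ∃ N, ∀ k, N ≤ k → c k = c N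

/-- A Lie algebra is just-infinite if it is infinite dimensional and every nonzero Lie ideal
has finite codimension. -/
def JustInfinite (K G : Type*) [Field K] [LieRing G] [LieAlgebra K G] : Prop :=
  ¬ FiniteDimensional K G ∧ ∀ I : LieIdeal K G, I ≠ ⊥ → FiniteDimensional K (G ⧸ I)

section

variable {K G : Type*} [Field K]

/-- A subspace of finite codimension has a finite-dimensional supplement. -/
lemma Submodule.CoFG.exists_fg_sup_eq_top {M : Type*} [AddCommGroup M] [Module K M]
    {S : Submodule K M} (hS : S.CoFG) : ∃ V : Submodule K M, V.FG ∧ S ⊔ V = ⊤ := by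
  obtain ⟨V, hV⟩ := S.exists_isCompl
  exact ⟨V, hS.fg_of_isCompl hV, hV.sup_eq_top⟩

/-- A subspace has finite codimension as soon as it does after adding a finite-dimensional
subspace. -/
lemma Submodule.CoFG.of_sup_fg {M : Type*} [AddCommGroup M] [Module K M]
    {S V : Submodule K M} (hV : V.FG) (hS : (S ⊔ V).CoFG) : S.CoFG := by
  obtain ⟨W, hW, hSW⟩ := hS.exists_fg_sup_eq_top
  have hmap : (V ⊔ W).map S.mkQ = ⊤ := by
    have h := congrArg (Submodule.map S.mkQ) hSW
    rwa [sup_assoc, Submodule.map_sup, Submodule.mkQ_map_self, bot_sup_eq, Submodule.map_top,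
      Submodule.range_mkQ] at h
  exact ⟨hmap ▸ (hV.sup hW).map S.mkQ⟩

variable [LieRing G] [LieAlgebra K G]

/-- In a weakly Noetherian Lie algebra, a subalgebra `m` is finite-dimensional modulo any
subspace containing `[m,m]`. -/
lemma WeaklyNoetherian.exists_fg_le_sup (hG : WeaklyNoetherian K G) {m D : Submodule K G}
    (hm : ∀ x ∈ m, ∀ y ∈ m, ⁅x, y⁆ ∈ m) (hD : ∀ x ∈ m, ∀ y ∈ m, ⁅x, y⁆ ∈ D) :
    ∃ V : Submodule K G, V.FG ∧ V ≤ m ∧ m ≤ D ⊔ V := by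
  let M : LieSubalgebra K G := { m with lie_mem' := fun {x y} hx hy => hm x hx y hy }
  have hfin : (LieAlgebra.derivedSeries K M 1).toSubmodule.CoFG := hG M
  obtain ⟨V, hV, hsup⟩ := hfin.exists_fg_sup_eq_top
  have hder : (LieAlgebra.derivedSeries K M 1).toSubmodule ≤ D.comap M.toSubmodule.subtype := by
    rw [LieAlgebra.derivedSeries_def, LieAlgebra.derivedSeriesOfIdeal_succ,
      LieAlgebra.derivedSeriesOfIdeal_zero, LieSubmodule.lieIdeal_oper_eq_linear_span',
      Submodule.span_le]
    rintro _ ⟨x, -, y, -, rfl⟩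
    exact hD x x.2 y y.2
  refine ⟨V.map M.toSubmodule.subtype, hV.map _, Submodule.map_subtype_le _ _, fun x hx => ?_⟩
  have hx' : (⟨x, hx⟩ : M) ∈ (LieAlgebra.derivedSeries K M 1).toSubmodule ⊔ V :=
    hsup ▸ Submodule.mem_top
  obtain ⟨d, hd, v, hv, hdv⟩ := Submodule.mem_sup.1 hx'
  exact Submodule.mem_sup.2 ⟨d, hder hd, v, ⟨v, hv, rfl⟩, congrArg Subtype.val hdv⟩

/-- `c` is an ideal of the ideal `a` which contains `B` and is finite-dimensional modulo `B`. -/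
structure IsFiniteIdealExtension (a : LieIdeal K G) (B c : Submodule K G) : Prop where
  le : B ≤ c
  le_ideal : c ≤ a.toSubmodule
  lie_mem : ∀ y ∈ a, ∀ x ∈ c, ⁅y, x⁆ ∈ c
  fg : (c.map B.mkQ).FG

namespace IsFiniteIdealExtension

variable {a : LieIdeal K G} {B c d : Submodule K G}

lemma sup (hc : IsFiniteIdealExtension a B c) (hd : IsFiniteIdealExtension a B d) :
    IsFiniteIdealExtension a B (c ⊔ d) where
  le := hc.le.trans le_sup_left
  le_ideal := sup_le hc.le_ideal hd.le_ideal
  lie_mem y hy x hx := by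
    obtain ⟨u, hu, v, hv, rfl⟩ := Submodule.mem_sup.1 hx
    rw [lie_add]
    exact Submodule.add_mem_sup (hc.lie_mem y hy u hu) (hd.lie_mem y hy v hv)
  fg := by
    rw [Submodule.map_sup]
    exact hc.fg.sup hd.fg

lemma sup_map_ad (hG : WeaklyNoetherian K G) (hc : IsFiniteIdealExtension a B c) (g : G) :
    IsFiniteIdealExtension a B (c ⊔ c.map (LieAlgebra.ad K G g)) where
  le := hc.le.trans le_sup_left
  le_ideal := by
    refine sup_le hc.le_ideal ?_
    rintro _ ⟨x, hx, rfl⟩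
    exact a.lie_mem (hc.le_ideal hx)
  lie_mem y hy x hx := by
    obtain ⟨u, hu, _, ⟨v, hv, rfl⟩, rfl⟩ := Submodule.mem_sup.1 hx
    have h : ⁅y, u + ⁅g, v⁆⁆ = (⁅y, u⁆ + ⁅⁅y, g⁆, v⁆) + ⁅g, ⁅y, v⁆⁆ := by
      rw [lie_add, leibniz_lie y g v, add_assoc]
    change ⁅y, u + ⁅g, v⁆⁆ ∈ _
    rw [h]
    exact Submodule.add_mem_sup
      (c.add_mem (hc.lie_mem y hy u hu) (hc.lie_mem _ (lie_mem_left K G a y g hy) v hv))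
      ⟨⁅y, v⁆, hc.lie_mem y hy v hv, rfl⟩
  fg := by
    obtain ⟨V, hV, -, hcV⟩ := hG.exists_fg_le_sup (m := c) (D := c.comap (LieAlgebra.ad K G g))
      (fun x hx y hy => hc.lie_mem x (hc.le_ideal hx) y hy) fun x hx y hy => by
        change ⁅g, ⁅x, y⁆⁆ ∈ c
        rw [leibniz_lie, ← lie_skew x ⁅g, y⁆]
        exact c.add_mem (hc.lie_mem _ (a.lie_mem (hc.le_ideal hx)) _ hy)
          (c.neg_mem (hc.lie_mem _ (a.lie_mem (hc.le_ideal hy)) _ hx))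
    have hle : c ⊔ c.map (LieAlgebra.ad K G g) ≤ c ⊔ V.map (LieAlgebra.ad K G g) := by
      refine sup_le le_sup_left ((Submodule.map_mono hcV).trans ?_)
      rw [Submodule.map_sup]
      exact sup_le_sup_right (Submodule.map_comap_le _ _) _
    have hfg : ((c ⊔ V.map (LieAlgebra.ad K G g)).map B.mkQ).FG := by
      rw [Submodule.map_sup]
      exact hc.fg.sup ((hV.map _).map _)
    exact hfg.of_le (Submodule.map_mono hle)

/-- The centralizer modulo `B` of an element of a finite extension of `B` has finite
codimension. -/
lemma cofg_comap_ad (ha : a.toSubmodule.CoFG) (hc : IsFiniteIdealExtension a B c) {s : G}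
    (hs : s ∈ c) : (B.comap (LieAlgebra.ad K G s)).CoFG := by
  obtain ⟨V, hV, hsup⟩ := ha.exists_fg_sup_eq_top
  have hker : B.comap (LieAlgebra.ad K G s) = LinearMap.ker (B.mkQ ∘ₗ LieAlgebra.ad K G s) := by
    rw [LinearMap.ker_comp, Submodule.ker_mkQ]
  rw [hker, ← Submodule.range_fg_iff_ker_cofg, LinearMap.range_comp, LinearMap.range_eq_map,
    ← hsup, Submodule.map_sup, Submodule.map_sup]
  refine Submodule.FG.sup (hc.fg.of_le (Submodule.map_mono ?_)) ((hV.map _).map _)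
  rintro _ ⟨y, hy, rfl⟩
  change ⁅s, y⁆ ∈ c
  rw [← lie_skew]
  exact c.neg_mem (hc.lie_mem y hy s hs)

end IsFiniteIdealExtension

/-- The sum of all finite extensions of an ideal `B` of `a`, as an ideal of `G`. -/
def finiteExtensionsIdeal (hG : WeaklyNoetherian K G) (a : LieIdeal K G) (B : Submodule K G)
    (hB : IsFiniteIdealExtension a B B) : LieIdeal K G where
  carrier := {x | ∃ c, IsFiniteIdealExtension a B c ∧ x ∈ c}
  zero_mem' := ⟨B, hB, B.zero_mem⟩
  add_mem' := by
    rintro x y ⟨c, hc, hx⟩ ⟨d, hd, hy⟩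
    exact ⟨c ⊔ d, hc.sup hd, Submodule.add_mem_sup hx hy⟩
  smul_mem' := by
    rintro t x ⟨c, hc, hx⟩
    exact ⟨c, hc, c.smul_mem t hx⟩
  lie_mem := by
    rintro g x ⟨c, hc, hx⟩
    exact ⟨_, hc.sup_map_ad hG g, Submodule.mem_sup_right ⟨x, hx, rfl⟩⟩

/-- Among the subspaces of `L` that are abelian modulo `B` there is a maximal one. -/
lemma exists_maximal_lie_mem {B L : Submodule K G} (hBL : B ≤ L)
    (hB : ∀ x ∈ B, ∀ y ∈ B, ⁅x, y⁆ ∈ B) :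
    ∃ m, B ≤ m ∧
      Maximal (· ∈ {m : Submodule K G | m ≤ L ∧ ∀ x ∈ m, ∀ y ∈ m, ⁅x, y⁆ ∈ B}) m := by
  refine zorn_le_nonempty₀ {m : Submodule K G | m ≤ L ∧ ∀ x ∈ m, ∀ y ∈ m, ⁅x, y⁆ ∈ B}
    (fun C hC hchain m₀ hm₀ => ⟨sSup C, ⟨?_, ?_⟩, ?_⟩) B ⟨hBL, hB⟩
  · exact sSup_le fun m hm => (hC hm).1
  · intro x hx y hy
    rw [Submodule.mem_sSup_of_directed ⟨m₀, hm₀⟩ hchain.directedOn] at hx hy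
    obtain ⟨p, hp, hx⟩ := hx
    obtain ⟨q, hq, hy⟩ := hy
    rcases hchain.total hp hq with h | h
    · exact (hC hq).2 x (h hx) y hy
    · exact (hC hp).2 x hx y (h hy)
  · exact fun m hm => le_sSup hm

/-- If `x` is an element of `L` commuting modulo `B` with a subspace `m` that is maximal among the
subspaces of `L` abelian modulo `B`, then `x` belongs to `m`. -/
lemma mem_of_maximal_of_lie_mem {B L m : Submodule K G}
    (hm : Maximal (· ∈ {m : Submodule K G | m ≤ L ∧ ∀ x ∈ m, ∀ y ∈ m, ⁅x, y⁆ ∈ B}) m)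
    {x : G} (hxL : x ∈ L) (hx : ∀ y ∈ m, ⁅y, x⁆ ∈ B) : x ∈ m := by
  have hmem : m ⊔ K ∙ x ∈ {m : Submodule K G | m ≤ L ∧ ∀ x ∈ m, ∀ y ∈ m, ⁅x, y⁆ ∈ B} := by
    refine ⟨sup_le hm.prop.1 ((Submodule.span_singleton_le_iff_mem x L).2 hxL), ?_⟩
    intro y hy z hz
    obtain ⟨u, hu, _, hs, rfl⟩ := Submodule.mem_sup.1 hy
    obtain ⟨s, rfl⟩ := Submodule.mem_span_singleton.1 hs
    obtain ⟨v, hv, _, ht, rfl⟩ := Submodule.mem_sup.1 hz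
    obtain ⟨t, rfl⟩ := Submodule.mem_span_singleton.1 ht
    have h : ⁅u + s • x, v + t • x⁆ = ⁅u, v⁆ + t • ⁅u, x⁆ - s • ⁅v, x⁆ := by
      rw [← lie_skew v x]
      simp only [lie_add, add_lie, lie_smul, smul_lie, lie_self, smul_zero]
      module
    rw [h]
    exact B.sub_mem (B.add_mem (hm.prop.2 u hu v hv) (B.smul_mem t (hx u hu)))
      (B.smul_mem s (hx v hv))
  exact hm.le_of_ge hmem le_sup_left (Submodule.mem_sup_right (Submodule.mem_span_singleton_self x))

/-- In a weakly Noetherian just-infinite Lie algebra, a nonzero ideal of a nonzero ideal has finite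
codimension. -/
lemma JustInfinite.cofg_of_lie_mem (hG : WeaklyNoetherian K G) (hJI : JustInfinite K G)
    {a : LieIdeal K G} {B : Submodule K G} (hBa : B ≤ a.toSubmodule)
    (hB : ∀ y ∈ a, ∀ x ∈ B, ⁅y, x⁆ ∈ B) (hne : B ≠ ⊥) : B.CoFG := by
  have hBB : IsFiniteIdealExtension a B B :=
    ⟨le_rfl, hBa, hB, by rw [Submodule.mkQ_map_self]; exact Submodule.fg_bot⟩
  obtain ⟨b, hb, hb0⟩ := Submodule.exists_mem_ne_zero_of_ne_bot hne
  have ha : a.toSubmodule.CoFG :=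
    hJI.2 a fun h => hb0 ((LieSubmodule.mem_bot b).1 (h ▸ hBa hb))
  let L := finiteExtensionsIdeal hG a B hBB
  have hBL : B ≤ L.toSubmodule := fun x hx => ⟨B, hBB, hx⟩
  have hLa : L ≤ a := by
    rintro x ⟨c, hc, hx⟩
    exact hc.le_ideal hx
  have hL : L.toSubmodule.CoFG :=
    hJI.2 L fun h => hb0 ((LieSubmodule.mem_bot b).1 (h ▸ hBL hb))
  obtain ⟨m, hBm, hm⟩ := exists_maximal_lie_mem hBL fun x hx y hy => hB x (hBa hx) y hy
  obtain ⟨V, hV, hVm, hmV⟩ := hG.exists_fg_le_sup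
    (fun x hx y hy => hBm (hm.prop.2 x hx y hy)) hm.prop.2
  obtain ⟨S, rfl⟩ := hV
  have hZ : (sInf ((fun s => B.comap (LieAlgebra.ad K G s)) '' (S : Set G))).CoFG := by
    refine Submodule.CoFG.sInf_of_finite (S.finite_toSet.image _) ?_
    rintro _ ⟨s, hs, rfl⟩
    obtain ⟨c, hc, hsc⟩ := hm.prop.1 (hVm (Submodule.subset_span hs))
    exact hc.cofg_comap_ad ha hsc
  refine Submodule.CoFG.of_sup_fg ⟨S, rfl⟩ ((hZ.inf hL).of_le fun x hx => hmV ?_)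
  refine mem_of_maximal_of_lie_mem hm hx.2 fun y hy => ?_
  have hBx : B ≤ B.comap (LieAlgebra.ad K G x) := fun z hz => hB x (hLa hx.2) z hz
  have hSx : Submodule.span K (S : Set G) ≤ B.comap (LieAlgebra.ad K G x) := by
    rw [Submodule.span_le]
    intro s hs
    change ⁅x, s⁆ ∈ B
    rw [← lie_skew]
    exact B.neg_mem (Submodule.mem_sInf.1 hx.1 _ ⟨s, hs, rfl⟩)
  have hxy : ⁅x, y⁆ ∈ B := sup_le hBx hSx (hmV hy)
  rw [← lie_skew]
  exact B.neg_mem hxy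

end

/-- In a just-infinite Noetherian Lie algebra, every nonzero Lie ideal is
itself just-infinite as a Lie algebra. -/
theorem lieNoetherian_justInfinite_ideal_justInfinite
    (K G : Type*) [Field K] [CharZero K] [LieRing G] [LieAlgebra K G]
    (hG : LieNoetherian K G) (hJI : JustInfinite K G)
    (a : LieIdeal K G) (ha : a ≠ ⊥) :
    JustInfinite K ↥a := by
  refine ⟨fun hfin => hJI.1 ?_, fun I hI => ?_⟩
  · have : FiniteDimensional K (G ⧸ a.toSubmodule) := hJI.2 a ha
    have : FiniteDimensional K a.toSubmodule := hfin
    exact Module.Finite.of_submodule_quotient a.toSubmodule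
  · let B : Submodule K G := I.toSubmodule.map a.toSubmodule.subtype
    have hBa : B ≤ a.toSubmodule := Submodule.map_subtype_le _ _
    have hB : ∀ y ∈ a, ∀ x ∈ B, ⁅y, x⁆ ∈ B := by
      rintro y hy _ ⟨x, hx, rfl⟩
      exact ⟨⁅(⟨y, hy⟩ : a), x⁆, I.lie_mem hx, rfl⟩
    have hne : B ≠ ⊥ := by
      rwa [Ne, ← le_bot_iff, Submodule.map_le_iff_le_comap, Submodule.comap_bot,
        Submodule.ker_subtype, le_bot_iff,
        LieSubmodule.toSubmodule_eq_bot]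
    have hfin : FiniteDimensional K (G ⧸ B) := hJI.cofg_of_lie_mem hG.1 hBa hB hne
    have hker : LinearMap.ker (B.mkQ ∘ₗ a.toSubmodule.subtype) = I.toSubmodule := by
      rw [LinearMap.ker_comp, Submodule.ker_mkQ,
        Submodule.comap_map_eq_of_injective a.toSubmodule.injective_subtype]
    have hI' : (LinearMap.ker (B.mkQ ∘ₗ a.toSubmodule.subtype)).CoFG := Submodule.CoFG.ker _
    rw [hker] at hI'
    exact hI'
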